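/- Let q be a complex number with |q| < 1. Then Σ_{i,j≥0} (−1)^(T(i−j)) · q^(3i²+2ij+3j²+4i+4j) / ((q⁴;q⁴)_i · (q⁴;q⁴)_j) = 1 / ((q¹⁶;q⁴⁰)_∞ · (q²⁴;q⁴⁰)_∞), where for an integer t, T(t) = t(t−1)/2. (This is the Chen–Yin identity Σ_{i,j≥0} (−1)^(T(i−j)) q^(3i²/4+ij/2+3j²/4+i+j) / ((q;q)_i (q;q)_j) = 1/(q⁴, q⁶; q¹⁰)_∞ after the substitution q ↦ q⁴.) -/

import Mathlib

/-- Finite q-Pochhammer symbol `(a; q)_n = ∏_{k=0}^{n-1} (1 - a q^k)`. -/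
noncomputable def qPoch (a q : ℂ) (n : ℕ) : ℂ := ∏ k ∈ Finset.range n, (1 - a * q ^ k)

/-- Infinite q-Pochhammer symbol `(a; q)_∞ = ∏_{k=0}^{∞} (1 - a q^k)`. -/
noncomputable def qPochInf (a q : ℂ) : ℂ := ∏' k : ℕ, (1 - a * q ^ k)

/-- The sign `(-1)^(T(i-j))` where `T(t) = t(t-1)/2` is computed in the integers. -/
noncomputable def signT (i j : ℕ) : ℂ :=
  (-1 : ℂ) ^ ((((i : ℤ) - j) * ((i : ℤ) - j - 1)) / 2)

open Finset Filter Topology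

/-- The reciprocal `1 / (x; x)_n`. -/
noncomputable def invPoch (x : ℂ) (n : ℕ) : ℂ := (qPoch x x n)⁻¹

lemma one_sub_pow_ne_zero {x : ℂ} (hx : ‖x‖ < 1) (n : ℕ) : 1 - x ^ (n + 1) ≠ 0 := by
  intro h
  have h1 : ‖x ^ (n + 1)‖ < 1 := by
    rw [norm_pow]
    exact pow_lt_one₀ (norm_nonneg _) hx (Nat.succ_ne_zero n)
  rw [← sub_eq_zero.mp h] at h1
  simp at h1

lemma qPoch_succ (a x : ℂ) (n : ℕ) : qPoch a x (n + 1) = qPoch a x n * (1 - a * x ^ n) :=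
  prod_range_succ _ _

@[simp] lemma qPoch_zero (a x : ℂ) : qPoch a x 0 = 1 := prod_range_zero _

@[simp] lemma invPoch_zero (x : ℂ) : invPoch x 0 = 1 := by simp [invPoch]

lemma invPoch_rec {x : ℂ} (hx : ‖x‖ < 1) (n : ℕ) :
    (1 - x ^ (n + 1)) * invPoch x (n + 1) = invPoch x n := by
  have h := one_sub_pow_ne_zero hx n
  rw [invPoch, invPoch, qPoch_succ, ← pow_succ', mul_inv]
  field_simp

lemma summable_norm_mul_pow {x : ℂ} (a : ℂ) (hx : ‖x‖ < 1) :
    Summable fun n : ℕ => ‖-(a * x ^ n)‖ := by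
  simp only [norm_neg, norm_mul, norm_pow]
  exact (summable_geometric_of_lt_one (norm_nonneg _) hx).mul_left _

lemma tendsto_qPoch {x : ℂ} (a : ℂ) (hx : ‖x‖ < 1) :
    Tendsto (qPoch a x) atTop (𝓝 (qPochInf a x)) := by
  have h := (multipliable_one_add_of_summable (summable_norm_mul_pow a hx)).tendsto_prod_tprod_nat
  simp only [← sub_eq_add_neg] at h
  exact h

lemma qPochInf_ne_zero {x : ℂ} (hx : ‖x‖ < 1) (m : ℕ) : qPochInf (x ^ (m + 1)) x ≠ 0 := by
  have h := tprod_one_add_ne_zero_of_summable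
    (f := fun n : ℕ => -(x ^ (m + 1) * x ^ n)) (fun n => ?_) (summable_norm_mul_pow _ hx)
  · simp only [← sub_eq_add_neg] at h
    exact h
  · rw [← sub_eq_add_neg, ← pow_add, add_right_comm]
    exact one_sub_pow_ne_zero hx _

lemma tendsto_invPoch {x : ℂ} (hx : ‖x‖ < 1) :
    Tendsto (invPoch x) atTop (𝓝 (qPochInf x x)⁻¹) := by
  have h := qPochInf_ne_zero hx 0
  rw [zero_add, pow_one] at h
  exact (tendsto_qPoch x hx).inv₀ h

lemma exists_norm_invPoch_le {x : ℂ} (hx : ‖x‖ < 1) : ∃ C : ℝ, 0 ≤ C ∧ ∀ n, ‖invPoch x n‖ ≤ C := by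
  obtain ⟨C, hC⟩ := (tendsto_invPoch hx).norm.bddAbove_range
  exact ⟨C, (norm_nonneg _).trans (hC ⟨0, rfl⟩), fun n => hC ⟨n, rfl⟩⟩

lemma two_mul_choose_two_add (n : ℕ) : 2 * n.choose 2 + n = n * n := by
  induction n with
  | zero => simp
  | succ n ih => rw [Nat.choose_succ_succ' n 1, Nat.choose_one_right]; linarith

/-- A form of the `q`-Chu–Vandermonde summation. -/
lemma sum_antidiagonal_vandermonde {x : ℂ} (hx : ‖x‖ < 1) (M m : ℕ) :
    ∑ p ∈ antidiagonal M, x ^ (p.2 ^ 2 + m * p.2) * invPoch x p.1 * invPoch x p.2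
      * invPoch x (p.2 + m) = invPoch x M * invPoch x (M + m) := by
  induction M generalizing m with
  | zero => simp
  | succ M ih =>
    apply mul_left_cancel₀ (one_sub_pow_ne_zero hx M)
    rw [← mul_assoc, invPoch_rec hx, show M + 1 + m = M + (m + 1) by ring, ← ih (m + 1), mul_sum]
    have split : ∀ p ∈ antidiagonal (M + 1), (1 - x ^ (M + 1)) * (x ^ (p.2 ^ 2 + m * p.2)
        * invPoch x p.1 * invPoch x p.2 * invPoch x (p.2 + m)) =
        x ^ (p.2 ^ 2 + m * p.2) * invPoch x p.1 * ((1 - x ^ p.2) * invPoch x p.2)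
          * invPoch x (p.2 + m) +
        x ^ (p.2 ^ 2 + m * p.2 + p.2) * ((1 - x ^ p.1) * invPoch x p.1) * invPoch x p.2
          * invPoch x (p.2 + m) := by
      intro p hp
      rw [← HasAntidiagonal.mem_antidiagonal.mp hp]
      ring
    rw [sum_congr rfl split, sum_add_distrib, Nat.sum_antidiagonal_succ',
      Nat.sum_antidiagonal_succ, ← add_assoc, add_right_comm]
    simp only [pow_zero, sub_self, zero_mul, mul_zero, add_zero, zero_add, invPoch_rec hx]
    rw [← sum_add_distrib]
    refine sum_congr rfl fun p _ => ?_
    rw [← invPoch_rec hx (p.2 + m)]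
    ring_nf

/-- The finite Bailey lemma relative to `a = x`. -/
lemma bailey_lemma {x : ℂ} (hx : ‖x‖ < 1) {α β : ℕ → ℂ}
    (h : ∀ s, β s = ∑ p ∈ antidiagonal s, α p.2 * invPoch x p.1 * invPoch x (s + p.2 + 1))
    (N : ℕ) :
    ∑ p ∈ antidiagonal N, x ^ (p.2 ^ 2 + p.2) * invPoch x p.1 * β p.2 =
      ∑ p ∈ antidiagonal N, x ^ (p.2 ^ 2 + p.2) * α p.2 * invPoch x p.1
        * invPoch x (N + p.2 + 1) := by
  have inner : ∀ p ∈ antidiagonal N, x ^ (p.2 ^ 2 + p.2) * α p.2 * invPoch x p.1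
        * invPoch x (N + p.2 + 1) = ∑ r ∈ antidiagonal p.1, x ^ (p.2 ^ 2 + p.2) * α p.2 *
        (x ^ (r.2 ^ 2 + (2 * p.2 + 1) * r.2) * invPoch x r.1 * invPoch x r.2
          * invPoch x (r.2 + (2 * p.2 + 1))) := by
    intro p hp
    rw [← mul_sum, sum_antidiagonal_vandermonde hx,
      ← HasAntidiagonal.mem_antidiagonal.mp hp, ← mul_assoc]
    ring_nf
  rw [sum_congr rfl inner]
  simp only [h, mul_sum]
  rw [sum_sigma', sum_sigma']
  refine sum_nbij' (fun t => ⟨(t.1.1 + t.2.1, t.2.2), (t.1.1, t.2.1)⟩)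
    (fun t => ⟨(t.2.1, t.2.2 + t.1.2), (t.2.2, t.1.2)⟩) ?_ ?_ ?_ ?_ ?_
  · rintro ⟨⟨a, s⟩, ⟨b, j⟩⟩ h
    simp only [mem_sigma, HasAntidiagonal.mem_antidiagonal] at h ⊢
    exact ⟨by omega, trivial⟩
  · rintro ⟨⟨a, s⟩, ⟨b, j⟩⟩ h
    simp only [mem_sigma, HasAntidiagonal.mem_antidiagonal] at h ⊢
    exact ⟨by omega, trivial⟩
  · rintro ⟨⟨a, s⟩, ⟨b, j⟩⟩ h
    simp only [mem_sigma, HasAntidiagonal.mem_antidiagonal] at h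
    obtain ⟨-, rfl⟩ := h
    rfl
  · rintro ⟨⟨a, s⟩, ⟨b, j⟩⟩ h
    simp only [mem_sigma, HasAntidiagonal.mem_antidiagonal] at h
    obtain ⟨-, rfl⟩ := h
    rfl
  · rintro ⟨⟨a, s⟩, ⟨b, j⟩⟩ h
    simp only [mem_sigma, HasAntidiagonal.mem_antidiagonal] at h
    obtain ⟨-, rfl⟩ := h
    simp only
    ring_nf

/-- The sequence `α` of the unit Bailey pair relative to `a = x`. -/
noncomputable def unitAlpha (x : ℂ) (j : ℕ) : ℂ :=
  (-1) ^ j * x ^ j.choose 2 * (1 - x ^ (2 * j + 1))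

lemma sum_range_unitAlpha {x : ℂ} (hx : ‖x‖ < 1) (J d : ℕ) :
    (1 - x ^ (J + 1 + d)) * ∑ j ∈ range (J + 1),
      unitAlpha x j * invPoch x (J + 1 + d - j) * invPoch x (J + 1 + d + j + 1) =
      (-1) ^ J * x ^ (J + 1).choose 2 * (1 - x ^ (J + 1)) * invPoch x d
        * invPoch x (J + 1 + d + J + 1) := by
  induction J generalizing d with
  | zero =>
    simp only [zero_add, sum_range_one, unitAlpha, Nat.sub_zero, Nat.choose_zero_succ, pow_zero,
      add_zero, mul_zero, Nat.choose_succ_self, pow_one, one_mul]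
    rw [← invPoch_rec hx d, add_comm 1 d]
    ring
  | succ J ih =>
    have h := ih (d + 1)
    rw [show J + 1 + (d + 1) = J + 1 + 1 + d by ring] at h
    rw [sum_range_succ, mul_add, h, show J + 1 + 1 + d - (J + 1) = d + 1 by omega,
      ← invPoch_rec hx d, unitAlpha,
      show J + 1 + 1 + d + (J + 1) + 1 = J + 1 + 1 + d + J + 1 + 1 by ring,
      ← invPoch_rec hx (J + 1 + 1 + d + J + 1), Nat.choose_succ_succ' (J + 1) 1,
      Nat.choose_one_right]
    ring

lemma sum_antidiagonal_unitAlpha {x : ℂ} (hx : ‖x‖ < 1) (s : ℕ) :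
    (if s = 0 then 1 else 0) = ∑ p ∈ antidiagonal s,
      unitAlpha x p.2 * invPoch x p.1 * invPoch x (s + p.2 + 1) := by
  rw [← Nat.sum_antidiagonal_swap]
  simp only [Prod.fst_swap, Prod.snd_swap]
  rw [Nat.sum_antidiagonal_eq_sum_range_succ_mk]
  cases s with
  | zero =>
    have := invPoch_rec hx 0
    simpa [unitAlpha] using this.symm
  | succ J =>
    apply mul_left_cancel₀ (one_sub_pow_ne_zero hx J)
    have h := sum_range_unitAlpha hx J 0
    rw [add_zero] at h
    rw [sum_range_succ, mul_add, h, unitAlpha, Nat.sub_self, ← invPoch_rec hx (J + 1 + J + 1)]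
    simp only [Nat.add_eq_zero_iff, one_ne_zero, and_false, if_false]
    ring_nf

/-- A finite form of the second Rogers–Ramanujan identity. -/
lemma finite_rogersRamanujan {x : ℂ} (hx : ‖x‖ < 1) (N : ℕ) :
    ∑ p ∈ antidiagonal N, x ^ (p.2 ^ 2 + p.2) * invPoch x p.2 * invPoch x p.1 =
      ∑ p ∈ antidiagonal N, x ^ (2 * (p.2 ^ 2 + p.2)) * unitAlpha x p.2 * invPoch x p.1
        * invPoch x (N + p.2 + 1) := by
  have h1 : ∀ s, invPoch x s = ∑ p ∈ antidiagonal s,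
      (x ^ (p.2 ^ 2 + p.2) * unitAlpha x p.2) * invPoch x p.1 * invPoch x (s + p.2 + 1) := by
    intro s
    rw [← bailey_lemma hx (sum_antidiagonal_unitAlpha hx) s, sum_eq_single (s, 0)]
    · simp
    · rintro ⟨a, b⟩ hp hne
      rw [if_neg, mul_zero]
      rintro rfl
      simp_all
    · simp
  have h2 := bailey_lemma (α := fun j => x ^ (j ^ 2 + j) * unitAlpha x j) (β := invPoch x) hx h1 N
  simp only [mul_right_comm _ (invPoch x _) (invPoch x _), h2]
  refine sum_congr rfl fun p _ => ?_
  ring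

/-- Tannery's theorem for sums over antidiagonals. -/
lemma tendsto_sum_antidiagonal {h u v : ℕ → ℂ} {U V : ℂ} (hh : Summable fun j => ‖h j‖)
    (hu : Tendsto u atTop (𝓝 U)) (hv : Tendsto v atTop (𝓝 V)) :
    Tendsto (fun N => ∑ p ∈ antidiagonal N, h p.2 * u p.1 * v (N + p.2 + 1)) atTop
      (𝓝 ((∑' j, h j) * U * V)) := by
  obtain ⟨A, hA⟩ := hu.norm.bddAbove_range
  obtain ⟨B, hB⟩ := hv.norm.bddAbove_range
  replace hA : ∀ n, ‖u n‖ ≤ A := fun n => hA ⟨n, rfl⟩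
  replace hB : ∀ n, ‖v n‖ ≤ B := fun n => hB ⟨n, rfl⟩
  have hA0 : 0 ≤ A := (norm_nonneg _).trans (hA 0)
  have hB0 : 0 ≤ B := (norm_nonneg _).trans (hB 0)
  have key : ∀ N, ∑ p ∈ antidiagonal N, h p.2 * u p.1 * v (N + p.2 + 1) =
      ∑' j, if j ≤ N then h j * u (N - j) * v (N + j + 1) else 0 := by
    intro N
    rw [tsum_eq_sum (s := range (N + 1)), ← Nat.sum_antidiagonal_swap]
    · simp only [Prod.fst_swap, Prod.snd_swap]
      rw [Nat.sum_antidiagonal_eq_sum_range_succ_mk]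
      refine sum_congr rfl fun j hj => ?_
      rw [if_pos (Nat.lt_succ_iff.mp (mem_range.mp hj))]
    · intro j hj
      rw [if_neg]
      simpa [Nat.lt_succ_iff] using hj
  simp only [key]
  rw [← tsum_mul_right, ← tsum_mul_right]
  refine tendsto_tsum_of_dominated_convergence (bound := fun j => ‖h j‖ * (A * B))
    (hh.mul_right _) (fun j => ?_) (Eventually.of_forall fun N j => ?_)
  · have h1 : Tendsto (fun N => h j * u (N - j) * v (N + j + 1)) atTop (𝓝 (h j * U * V)) :=
      ((tendsto_const_nhds.mul (hu.comp (tendsto_sub_atTop_nat j))).mul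
        (hv.comp (tendsto_atTop_mono (fun n => (by omega : n ≤ n + j + 1)) tendsto_id)))
    refine h1.congr' ?_
    filter_upwards [eventually_ge_atTop j] with N hN
    rw [if_pos hN]
  · split_ifs
    · rw [norm_mul, norm_mul, mul_assoc]
      gcongr
      · exact hA _
      · exact hB _
    · rw [norm_zero]
      positivity

/-- Homogeneous form of the `q`-binomial theorem. -/
lemma sum_antidiagonal_qBinomial {y : ℂ} (hy : ‖y‖ < 1) (u v : ℂ) (M : ℕ) :
    ∑ p ∈ antidiagonal M, (-1) ^ p.1 * y ^ p.1.choose 2 * u ^ p.1 * v ^ p.2 * invPoch y p.1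
      * invPoch y p.2 = invPoch y M * ∏ k ∈ range M, (v - u * y ^ k) := by
  induction M generalizing u with
  | zero => simp
  | succ M ih =>
    apply mul_left_cancel₀ (one_sub_pow_ne_zero hy M)
    rw [← mul_assoc, invPoch_rec hy, prod_range_succ', pow_zero, mul_one, ← mul_assoc]
    simp only [pow_succ' y, ← mul_assoc u y]
    rw [← ih (u * y), mul_sum]
    have split : ∀ p ∈ antidiagonal (M + 1), (1 - y * y ^ M) * ((-1) ^ p.1 * y ^ p.1.choose 2
        * u ^ p.1 * v ^ p.2 * invPoch y p.1 * invPoch y p.2) =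
        (-1) ^ p.1 * y ^ p.1.choose 2 * u ^ p.1 * v ^ p.2 * ((1 - y ^ p.1) * invPoch y p.1)
          * invPoch y p.2 +
        (-1) ^ p.1 * y ^ p.1.choose 2 * (u * y) ^ p.1 * v ^ p.2 * invPoch y p.1
          * ((1 - y ^ p.2) * invPoch y p.2) := by
      intro p hp
      rw [← pow_succ', ← HasAntidiagonal.mem_antidiagonal.mp hp]
      ring
    rw [sum_congr rfl split, sum_add_distrib, Nat.sum_antidiagonal_succ,
      Nat.sum_antidiagonal_succ', ← add_assoc, add_right_comm]
    simp only [pow_zero, sub_self, zero_mul, mul_zero, add_zero, zero_add, invPoch_rec hy]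
    rw [← sum_add_distrib, sum_mul]
    refine sum_congr rfl fun p _ => ?_
    rw [Nat.choose_succ_succ' p.1 1, Nat.choose_one_right]
    ring

lemma sum_antidiagonal_two_mul_add_one (f : ℕ × ℕ → ℂ) (N : ℕ) :
    ∑ p ∈ antidiagonal (2 * N + 1), f p =
      ∑ p ∈ antidiagonal N, (f (N + p.2 + 1, p.1) + f (p.1, N + p.2 + 1)) := by
  rw [Nat.sum_antidiagonal_eq_sum_range_succ_mk, ← Nat.sum_antidiagonal_swap,
    Nat.sum_antidiagonal_eq_sum_range_succ_mk, show (2 * N + 1).succ = (N + 1) + (N + 1) by omega,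
    sum_range_add, sum_add_distrib, add_comm]
  congr 1
  · refine sum_congr rfl fun j hj => ?_
    have := mem_range.mp hj
    simp only [Prod.fst_swap, Prod.snd_swap]
    congr 2 <;> omega
  · rw [← sum_range_reflect]
    refine sum_congr rfl fun j hj => ?_
    have := mem_range.mp hj
    simp only [Prod.fst_swap, Prod.snd_swap]
    congr 2
    omega

lemma prod_range_jacobi (x : ℂ) (N : ℕ) :
    ∏ k ∈ range (2 * N + 1), ((x ^ 5) ^ (N + 1) - x ^ 4 * (x ^ 5) ^ k) =
      (-1) ^ (N + 1) * x ^ (5 * ((N + 1).choose 2 + N * (N + 1)) + 4 * (N + 1)) *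
        (qPoch x (x ^ 5) (N + 1) * qPoch (x ^ 4) (x ^ 5) N) := by
  rw [show 2 * N + 1 = (N + 1) + N by ring, prod_range_add]
  have h1 : ∏ k ∈ range N, ((x ^ 5) ^ (N + 1) - x ^ 4 * (x ^ 5) ^ (N + 1 + k)) =
      x ^ (5 * (N * (N + 1))) * qPoch (x ^ 4) (x ^ 5) N := by
    have : ∀ k ∈ range N, (x ^ 5) ^ (N + 1) - x ^ 4 * (x ^ 5) ^ (N + 1 + k) =
        (x ^ 5) ^ (N + 1) * (1 - x ^ 4 * (x ^ 5) ^ k) := fun k _ => by ring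
    rw [prod_congr rfl this, prod_mul_distrib, prod_const, card_range, qPoch]
    ring
  have h2 : ∏ k ∈ range (N + 1), ((x ^ 5) ^ (N + 1) - x ^ 4 * (x ^ 5) ^ k) =
      (-1) ^ (N + 1) * x ^ (5 * (N + 1).choose 2 + 4 * (N + 1)) * qPoch x (x ^ 5) (N + 1) := by
    have : ∀ k ∈ range (N + 1), (x ^ 5) ^ (N + 1) - x ^ 4 * (x ^ 5) ^ k =
        -x ^ 4 * (x ^ 5) ^ k * (1 - x * (x ^ 5) ^ (N + 1 - 1 - k)) := by
      intro k hk
      obtain ⟨d, rfl⟩ := Nat.exists_eq_add_of_le (Nat.lt_succ_iff.mp (mem_range.mp hk))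
      rw [show k + d + 1 - 1 - k = d by omega]
      ring
    rw [prod_congr rfl this, prod_mul_distrib, prod_mul_distrib, prod_const, card_range,
      prod_pow_eq_pow_sum, sum_range_id, ← Nat.choose_two_right,
      prod_range_reflect (fun k => 1 - x * (x ^ 5) ^ k), qPoch, neg_pow]
    ring
  rw [h1, h2]
  ring

lemma sum_antidiagonal_jacobi {x : ℂ} (hx : ‖x‖ < 1) (hx0 : x ≠ 0) (N : ℕ) :
    ∑ p ∈ antidiagonal N, (x ^ (2 * (p.2 ^ 2 + p.2)) * unitAlpha x p.2) * invPoch (x ^ 5) p.1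
      * invPoch (x ^ 5) (N + p.2 + 1) =
    invPoch (x ^ 5) (2 * N + 1) * (qPoch x (x ^ 5) (N + 1) * qPoch (x ^ 4) (x ^ 5) N) := by
  have hy : ‖x ^ 5‖ < 1 := by
    rw [norm_pow]
    exact pow_lt_one₀ (norm_nonneg _) hx (by norm_num)
  have h := sum_antidiagonal_qBinomial hy (x ^ 4) ((x ^ 5) ^ (N + 1)) (2 * N + 1)
  rw [prod_range_jacobi, sum_antidiagonal_two_mul_add_one] at h
  set K : ℂ := (-1) ^ (N + 1) * x ^ (5 * ((N + 1).choose 2 + N * (N + 1)) + 4 * (N + 1)) with hK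
  have hK0 : K ≠ 0 := by simp [hK, hx0]
  apply mul_left_cancel₀ hK0
  rw [mul_left_comm K (invPoch _ _), ← h, mul_sum]
  refine sum_congr rfl fun p hp => ?_
  obtain ⟨c, j⟩ := p
  obtain rfl : c + j = N := HasAntidiagonal.mem_antidiagonal.mp hp
  have e0 := two_mul_choose_two_add j
  have e1 := two_mul_choose_two_add c
  have e2 := two_mul_choose_two_add (c + j + 1)
  have e3 := two_mul_choose_two_add (c + j + j + 1)
  simp only [unitAlpha, hK, ← pow_mul]
  have t1 : (-1 : ℂ) ^ (c + j + j + 1) * x ^ (5 * (c + j + j + 1).choose 2) *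
      x ^ (4 * (c + j + j + 1)) * x ^ (5 * (c + j + 1) * c) =
      (-1) ^ (c + j + 1) * (-1) ^ j * x ^ (5 * ((c + j + 1).choose 2 + (c + j) * (c + j + 1))
        + 4 * (c + j + 1) + 2 * (j ^ 2 + j) + j.choose 2) := by
    rw [mul_assoc, mul_assoc, ← pow_add, ← pow_add, ← pow_add]
    congr 2
    · ring
    · nlinarith
  have t2 : (-1 : ℂ) ^ c * x ^ (5 * c.choose 2) *
      x ^ (4 * c) * x ^ (5 * (c + j + 1) * (c + j + j + 1)) =
      - ((-1) ^ (c + j + 1) * (-1) ^ j * x ^ (5 * ((c + j + 1).choose 2 + (c + j) * (c + j + 1))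
        + 4 * (c + j + 1) + 2 * (j ^ 2 + j) + j.choose 2 + (2 * j + 1))) := by
    rw [mul_assoc, mul_assoc, ← pow_add, ← pow_add, ← neg_mul]
    congr 2
    · rw [← pow_add, show c + j + 1 + j = c + 2 * j + 1 by ring, pow_succ, pow_add, pow_mul]
      simp
    · nlinarith
  rw [t1, t2]
  ring

lemma tsum_jacobi {x : ℂ} (hx : ‖x‖ < 1)
    (hs : Summable fun j => ‖x ^ (2 * (j ^ 2 + j)) * unitAlpha x j‖) :
    ∑' j, x ^ (2 * (j ^ 2 + j)) * unitAlpha x j =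
      qPochInf x (x ^ 5) * qPochInf (x ^ 4) (x ^ 5) * qPochInf (x ^ 5) (x ^ 5) := by
  rcases eq_or_ne x 0 with rfl | hx0
  · rw [tsum_eq_single 0]
    · simp [unitAlpha, qPochInf]
    · intro j hj
      simp [hj]
  have hy : ‖x ^ 5‖ < 1 := by
    rw [norm_pow]
    exact pow_lt_one₀ (norm_nonneg _) hx (by norm_num)
  have hR := tendsto_invPoch hy
  have h0 : qPochInf (x ^ 5) (x ^ 5) ≠ 0 := by simpa using qPochInf_ne_zero hy 0
  have h1 := tendsto_sum_antidiagonal hs hR hR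
  have h2 := (hR.comp (tendsto_atTop_mono (fun n : ℕ => (by omega : n ≤ 2 * n + 1))
    tendsto_id)).mul (((tendsto_qPoch x hy).comp (tendsto_add_atTop_nat 1)).mul
      (tendsto_qPoch (x ^ 4) hy))
  have h3 := tendsto_nhds_unique h1 (h2.congr fun N => (sum_antidiagonal_jacobi hx hx0 N).symm)
  field_simp at h3
  rw [h3]
  ring

lemma tsum_rogersRamanujan_aux {x : ℂ} (hx : ‖x‖ < 1)
    (hs : Summable fun j => ‖x ^ (j ^ 2 + j) * invPoch x j‖)
    (hs' : Summable fun j => ‖x ^ (2 * (j ^ 2 + j)) * unitAlpha x j‖) :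
    qPochInf x x * ∑' j, x ^ (j ^ 2 + j) * invPoch x j =
      ∑' j, x ^ (2 * (j ^ 2 + j)) * unitAlpha x j := by
  have hR := tendsto_invPoch hx
  have h0 : qPochInf x x ≠ 0 := by simpa using qPochInf_ne_zero hx 0
  have h1 := tendsto_sum_antidiagonal hs hR (tendsto_const_nhds (x := (1 : ℂ)))
  have h2 := tendsto_sum_antidiagonal hs' hR hR
  simp only [mul_one, finite_rogersRamanujan hx] at h1
  have h3 := tendsto_nhds_unique h1 h2
  field_simp at h3
  rw [mul_comm, h3]

lemma qPoch_five_mul (x : ℂ) (n : ℕ) :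
    qPoch x x (5 * n) = qPoch x (x ^ 5) n * qPoch (x ^ 2) (x ^ 5) n * qPoch (x ^ 3) (x ^ 5) n *
      qPoch (x ^ 4) (x ^ 5) n * qPoch (x ^ 5) (x ^ 5) n := by
  induction n with
  | zero => simp
  | succ n ih =>
    rw [show 5 * (n + 1) = 5 * n + 1 + 1 + 1 + 1 + 1 by ring]
    simp only [qPoch_succ]
    rw [ih]
    ring

lemma qPochInf_eq_five {x : ℂ} (hx : ‖x‖ < 1) :
    qPochInf x x = qPochInf x (x ^ 5) * qPochInf (x ^ 2) (x ^ 5) * qPochInf (x ^ 3) (x ^ 5) *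
      qPochInf (x ^ 4) (x ^ 5) * qPochInf (x ^ 5) (x ^ 5) := by
  have hy : ‖x ^ 5‖ < 1 := by
    rw [norm_pow]
    exact pow_lt_one₀ (norm_nonneg _) hx (by norm_num)
  have h1 := (tendsto_qPoch x hx).comp
    (tendsto_atTop_mono (fun n : ℕ => (by omega : n ≤ 5 * n)) tendsto_id)
  have h2 := ((((tendsto_qPoch x hy).mul (tendsto_qPoch (x ^ 2) hy)).mul
    (tendsto_qPoch (x ^ 3) hy)).mul (tendsto_qPoch (x ^ 4) hy)).mul (tendsto_qPoch (x ^ 5) hy)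
  exact tendsto_nhds_unique h1 (h2.congr fun n => (qPoch_five_mul x n).symm)

lemma summable_pow_mul_of_bounded {x : ℂ} (hx : ‖x‖ < 1) {e : ℕ → ℕ} (he : ∀ n, n ≤ e n)
    {b : ℕ → ℂ} {C : ℝ} (hb : ∀ n, ‖b n‖ ≤ C) : Summable fun n => ‖x ^ e n * b n‖ := by
  refine Summable.of_nonneg_of_le (fun n => norm_nonneg _) (fun n => ?_)
    ((summable_geometric_of_lt_one (norm_nonneg x) hx).mul_right C)
  rw [norm_mul, norm_pow]
  exact mul_le_mul (pow_le_pow_of_le_one (norm_nonneg _) hx.le (he n)) (hb n) (norm_nonneg _)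
    (pow_nonneg (norm_nonneg _) _)

lemma norm_unitAlpha_le {x : ℂ} (hx : ‖x‖ < 1) (j : ℕ) : ‖unitAlpha x j‖ ≤ 2 := by
  have h : ∀ n, ‖x ^ n‖ ≤ 1 := fun n => by
    rw [norm_pow]
    exact pow_le_one₀ (norm_nonneg _) hx.le
  rw [unitAlpha, norm_mul, norm_mul, norm_pow, norm_neg, norm_one, one_pow, one_mul]
  calc ‖x ^ j.choose 2‖ * ‖1 - x ^ (2 * j + 1)‖ ≤ 1 * (1 + 1) := by
        gcongr
        · exact h _
        · exact (norm_sub_le _ _).trans (by rw [norm_one]; gcongr; exact h _)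
    _ = 2 := by norm_num

/-- The second Rogers–Ramanujan identity. -/
theorem tsum_rogersRamanujan {x : ℂ} (hx : ‖x‖ < 1) :
    ∑' n, x ^ (n ^ 2 + n) * invPoch x n =
      1 / (qPochInf (x ^ 2) (x ^ 5) * qPochInf (x ^ 3) (x ^ 5)) := by
  obtain ⟨C, -, hC⟩ := exists_norm_invPoch_le hx
  have hs : Summable fun j => ‖x ^ (j ^ 2 + j) * invPoch x j‖ :=
    summable_pow_mul_of_bounded hx (fun n => by nlinarith) hC
  have hs' : Summable fun j => ‖x ^ (2 * (j ^ 2 + j)) * unitAlpha x j‖ :=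
    summable_pow_mul_of_bounded hx (fun n => by nlinarith) (norm_unitAlpha_le hx)
  have h := tsum_rogersRamanujan_aux hx hs hs'
  have h0 : qPochInf x x ≠ 0 := by simpa using qPochInf_ne_zero hx 0
  rw [tsum_jacobi hx hs', qPochInf_eq_five hx] at h
  rw [qPochInf_eq_five hx] at h0
  simp only [mul_ne_zero_iff] at h0
  obtain ⟨⟨⟨⟨h1, h2⟩, h3⟩, h4⟩, h5⟩ := h0
  field_simp at h ⊢
  linear_combination h

/-- The coefficients `x ^ (n choose 2) / (x; x)_n` of Euler's expansion of `(-t; x)_∞`. -/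
noncomputable def eulerCoeff (x : ℂ) (n : ℕ) : ℂ := x ^ n.choose 2 * invPoch x n

lemma mk_eulerCoeff_eq {x : ℂ} (hx : ‖x‖ < 1) :
    PowerSeries.mk (eulerCoeff x) =
      (1 + PowerSeries.X) * PowerSeries.rescale x (PowerSeries.mk (eulerCoeff x)) := by
  ext n
  rw [add_mul, one_mul, map_add]
  cases n with
  | zero => simp
  | succ n =>
    rw [PowerSeries.coeff_succ_X_mul]
    simp only [PowerSeries.coeff_rescale, PowerSeries.coeff_mk, eulerCoeff]
    rw [← invPoch_rec hx n, Nat.choose_succ_succ' n 1, Nat.choose_one_right]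
    ring

lemma mk_eulerCoeff_mul_rescale_eq {x : ℂ} (hx : ‖x‖ < 1) :
    PowerSeries.mk (eulerCoeff x) * PowerSeries.rescale (-1) (PowerSeries.mk (eulerCoeff x)) =
      (1 - PowerSeries.X ^ 2) * PowerSeries.rescale x (PowerSeries.mk (eulerCoeff x) *
        PowerSeries.rescale (-1) (PowerSeries.mk (eulerCoeff x))) := by
  conv_lhs => rw [mk_eulerCoeff_eq hx]
  simp only [map_mul, map_add, map_one, PowerSeries.rescale_X, PowerSeries.rescale_rescale,
    map_neg, mul_comm x (-1)]
  ring

lemma sum_antidiagonal_eulerCoeff {x : ℂ} (hx : ‖x‖ < 1) (N : ℕ) :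
    ∑ p ∈ antidiagonal (2 * N), eulerCoeff x p.1 * ((-1) ^ p.2 * eulerCoeff x p.2) =
      (-1) ^ N * x ^ (2 * N.choose 2) * invPoch (x ^ 2) N := by
  have hx2 : ‖x ^ 2‖ < 1 := by
    rw [norm_pow]
    exact pow_lt_one₀ (norm_nonneg _) hx two_ne_zero
  have hcoeff : ∀ n, ∑ p ∈ antidiagonal n, eulerCoeff x p.1 * ((-1) ^ p.2 * eulerCoeff x p.2) =
      PowerSeries.coeff n (PowerSeries.mk (eulerCoeff x) *
        PowerSeries.rescale (-1) (PowerSeries.mk (eulerCoeff x))) := by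
    intro n
    simp only [PowerSeries.coeff_mul, PowerSeries.coeff_rescale, PowerSeries.coeff_mk]
  induction N with
  | zero => simp [eulerCoeff]
  | succ N ih =>
    rw [hcoeff] at ih ⊢
    have h := congrArg (PowerSeries.coeff (2 * N + 2)) (mk_eulerCoeff_mul_rescale_eq hx)
    rw [sub_mul, one_mul, map_sub, PowerSeries.coeff_X_pow_mul, PowerSeries.coeff_rescale,
      PowerSeries.coeff_rescale, ih] at h
    apply mul_left_cancel₀ (one_sub_pow_ne_zero hx2 N)
    rw [← invPoch_rec hx2 N] at h
    rw [show 2 * (N + 1) = 2 * N + 2 by ring, Nat.choose_succ_succ' N 1, Nat.choose_one_right]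
    linear_combination h

lemma signT_of_add_eq_two_mul {i j N : ℕ} (h : i + j = 2 * N) :
    signT i j = (-1) ^ N * (-1) ^ j := by
  have h1 : ((i : ℤ) - j) * ((i : ℤ) - j - 1) / 2 = (2 * ((N : ℤ) - j) - 1) * (N - j) := by
    have : (i : ℤ) = 2 * N - j := by omega
    rw [this]
    apply Int.ediv_eq_of_eq_mul_left two_ne_zero
    ring
  have h2 : Odd (2 * ((N : ℤ) - j) - 1) := ⟨N - j - 1, by ring⟩
  rw [signT, h1, zpow_mul, h2.neg_one_zpow, zpow_sub₀ (by norm_num), zpow_natCast, zpow_natCast,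
    div_eq_mul_inv, ← inv_pow, inv_neg_one]

lemma signT_swap_of_add_eq {i j N : ℕ} (h : i + j = 2 * N + 1) : signT j i = -signT i j := by
  have hi : (i : ℤ) = 2 * N + 1 - j := by omega
  have h1 : ((i : ℤ) - j) * ((i : ℤ) - j - 1) / 2 = (2 * ((N : ℤ) - j) + 1) * (N - j) := by
    rw [hi]
    apply Int.ediv_eq_of_eq_mul_left two_ne_zero
    ring
  have h2 : ((j : ℤ) - i) * ((j : ℤ) - i - 1) / 2 =
      (2 * ((N : ℤ) - j) + 1) * (N - j) + (2 * ((N : ℤ) - j) + 1) := by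
    rw [hi]
    apply Int.ediv_eq_of_eq_mul_left two_ne_zero
    ring
  have h3 : Odd (2 * ((N : ℤ) - j) + 1) := ⟨N - j, rfl⟩
  rw [signT, signT, h1, h2, zpow_add₀ (by norm_num), h3.neg_one_zpow, mul_neg_one]

/-- The general term of the Chen–Yin double series. -/
noncomputable def chenYinTerm (q : ℂ) (p : ℕ × ℕ) : ℂ :=
  signT p.1 p.2 * q ^ (3 * p.1 ^ 2 + 2 * p.1 * p.2 + 3 * p.2 ^ 2 + 4 * p.1 + 4 * p.2) /
    (qPoch (q ^ 4) (q ^ 4) p.1 * qPoch (q ^ 4) (q ^ 4) p.2)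

lemma sum_antidiagonal_chenYinTerm_odd (q : ℂ) (N : ℕ) :
    ∑ p ∈ antidiagonal (2 * N + 1), chenYinTerm q p = 0 := by
  have h : ∑ p ∈ antidiagonal (2 * N + 1), chenYinTerm q p =
      -∑ p ∈ antidiagonal (2 * N + 1), chenYinTerm q p := by
    conv_lhs => rw [← Nat.sum_antidiagonal_swap]
    rw [← sum_neg_distrib]
    refine sum_congr rfl fun p hp => ?_
    simp only [chenYinTerm, Prod.fst_swap, Prod.snd_swap]
    rw [signT_swap_of_add_eq (HasAntidiagonal.mem_antidiagonal.mp hp)]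
    ring_nf
  exact self_eq_neg.mp h

lemma sum_antidiagonal_chenYinTerm_even {q : ℂ} (hq : ‖q‖ < 1) (N : ℕ) :
    ∑ p ∈ antidiagonal (2 * N), chenYinTerm q p = (q ^ 8) ^ (N ^ 2 + N) * invPoch (q ^ 8) N := by
  have hx : ‖q ^ 4‖ < 1 := by
    rw [norm_pow]
    exact pow_lt_one₀ (norm_nonneg _) hq four_ne_zero
  have term : ∀ p ∈ antidiagonal (2 * N), chenYinTerm q p = (-1) ^ N * q ^ (4 * N ^ 2 + 12 * N) *
      (eulerCoeff (q ^ 4) p.1 * ((-1) ^ p.2 * eulerCoeff (q ^ 4) p.2)) := by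
    rintro ⟨i, j⟩ hp
    have hij : i + j = 2 * N := HasAntidiagonal.mem_antidiagonal.mp hp
    have e : 3 * i ^ 2 + 2 * i * j + 3 * j ^ 2 + 4 * i + 4 * j =
        4 * N ^ 2 + 12 * N + 4 * i.choose 2 + 4 * j.choose 2 := by
      have e1 := two_mul_choose_two_add i
      have e2 := two_mul_choose_two_add j
      have e3 : (i + j) ^ 2 = (2 * N) ^ 2 := by rw [hij]
      nlinarith
    simp only [chenYinTerm, eulerCoeff, invPoch]
    rw [signT_of_add_eq_two_mul hij, e, div_eq_mul_inv, mul_inv]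
    ring
  have hN := two_mul_choose_two_add N
  rw [sum_congr rfl term, ← mul_sum, sum_antidiagonal_eulerCoeff hx]
  have hs : (-1 : ℂ) ^ N * (-1) ^ N = 1 := by rw [← mul_pow]; simp
  have hp : q ^ (4 * N ^ 2 + 12 * N) * (q ^ 4) ^ (2 * N.choose 2) = (q ^ 8) ^ (N ^ 2 + N) := by
    rw [← pow_mul, ← pow_mul, ← pow_add]
    congr 1
    nlinarith
  rw [← hp, ← pow_mul q 4 2, show 4 * 2 = 8 from rfl]
  linear_combination q ^ (4 * N ^ 2 + 12 * N) * (q ^ 4) ^ (2 * N.choose 2) * invPoch (q ^ 8) N * hs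

lemma norm_signT (i j : ℕ) : ‖signT i j‖ = 1 := by
  rw [signT, norm_zpow, norm_neg, norm_one, one_zpow]

lemma summable_chenYinTerm {q : ℂ} (hq : ‖q‖ < 1) : Summable (chenYinTerm q) := by
  have hx : ‖q ^ 4‖ < 1 := by
    rw [norm_pow]
    exact pow_lt_one₀ (norm_nonneg _) hq four_ne_zero
  obtain ⟨C, hC0, hC⟩ := exists_norm_invPoch_le hx
  have hg := summable_geometric_of_lt_one (norm_nonneg q) hq
  have hb := (hg.mul_of_nonneg hg (fun n => pow_nonneg (norm_nonneg q) n)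
    (fun n => pow_nonneg (norm_nonneg q) n)).mul_right (C * C)
  refine hb.of_norm_bounded fun p => ?_
  rw [chenYinTerm, div_eq_mul_inv, mul_inv, norm_mul, norm_mul, norm_mul, norm_signT, one_mul,
    norm_pow, ← pow_add]
  refine mul_le_mul (pow_le_pow_of_le_one (norm_nonneg _) hq.le (by nlinarith))
    (mul_le_mul (hC p.1) (hC p.2) (norm_nonneg _) hC0) (by positivity) (by positivity)

lemma tsum_chenYinTerm {q : ℂ} (hq : ‖q‖ < 1) :
    ∑' p, chenYinTerm q p = ∑' N, (q ^ 8) ^ (N ^ 2 + N) * invPoch (q ^ 8) N := by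
  have hs := (HasAntidiagonal.sigmaAntidiagonalEquivProd (A := ℕ)).summable_iff.mpr
    (summable_chenYinTerm hq)
  rw [← HasAntidiagonal.sigmaAntidiagonalEquivProd.tsum_eq]
  refine (hs.tsum_sigma' fun n => (hasSum_fintype _).summable).trans ?_
  have inner : ∀ n, ∑' c : antidiagonal n,
      chenYinTerm q (HasAntidiagonal.sigmaAntidiagonalEquivProd ⟨n, c⟩) =
      ∑ p ∈ antidiagonal n, chenYinTerm q p := fun n => by
    rw [← Finset.tsum_subtype]
    rfl
  simp only [Function.comp_apply, inner]
  rw [← (mul_right_injective₀ (two_ne_zero (α := ℕ))).tsum_eq]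
  · exact tsum_congr fun N => sum_antidiagonal_chenYinTerm_even hq N
  · intro n hn
    rcases Nat.even_or_odd' n with ⟨N, rfl | rfl⟩
    · exact ⟨N, rfl⟩
    · exact absurd (sum_antidiagonal_chenYinTerm_odd q N) hn

theorem stmt_5 (q : ℂ) (hq : ‖q‖ < 1) :
    (∑' p : ℕ × ℕ,
        signT p.1 p.2 *
          q ^ (3 * p.1 ^ 2 + 2 * p.1 * p.2 + 3 * p.2 ^ 2 + 4 * p.1 + 4 * p.2) /
          (qPoch (q ^ 4) (q ^ 4) p.1 * qPoch (q ^ 4) (q ^ 4) p.2))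
      = 1 / (qPochInf (q ^ 16) (q ^ 40) * qPochInf (q ^ 24) (q ^ 40)) := by
  have hx : ‖q ^ 8‖ < 1 := by
    rw [norm_pow]
    exact pow_lt_one₀ (norm_nonneg _) hq (by norm_num)
  have h := (tsum_chenYinTerm hq).trans (tsum_rogersRamanujan hx)
  simp only [← pow_mul, Nat.reduceMul] at h
  exact h
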